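/- For every integer j ≥ 0 there is an isomorphism of sl₂-modules 𝓡_{(j)} ≅ ⊕_{i=j}^{min(g−1, 2j, ⌊(g+j)/2⌋)} V(g−2i+j)^{⊕μ(i,j)}, where the multiplicity is μ(i, j) = dim_ℚ( M^i_{(j)} / 𝒟^{g−2i+j+1}(M^{g−i+j+1}_{(j)}) ). -/

import Mathlib

open MvPolynomial

noncomputable section

def codimW (d : ℕ →₀ ℕ) : ℕ := d.sum fun v e => (v + 1) * e
def levelW (d : ℕ →₀ ℕ) : ℕ := d.sum fun v e => v * e

def Rij (i j : ℕ) : Submodule ℚ (MvPolynomial ℕ ℚ) :=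
  Submodule.span ℚ
    { p | ∃ d : ℕ →₀ ℕ, codimW d = i ∧ levelW d = j ∧ p = monomial d (1 : ℚ) }

/-- `R_{(j)} = ⊕_i R^i_{(j)}`: span of all monomials of level `j`. -/
def Rlev (j : ℕ) : Submodule ℚ (MvPolynomial ℕ ℚ) :=
  Submodule.span ℚ { p | ∃ d : ℕ →₀ ℕ, levelW d = j ∧ p = monomial d (1 : ℚ) }

def Dop (g : ℕ) (p : MvPolynomial ℕ ℚ) : MvPolynomial ℕ ℚ :=
  -(g : ℚ) • pderiv 0 p +
    (1/2 : ℚ) •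
      ∑ a ∈ Finset.range (p.vars.sup id + 1), ∑ b ∈ Finset.range (p.vars.sup id + 1),
        (((a + b + 2).choose (b + 1) : ℚ)) • (X (a + b) * pderiv a (pderiv b p))

def Rgt (g : ℕ) : Submodule ℚ (MvPolynomial ℕ ℚ) :=
  Submodule.span ℚ { p | ∃ d : ℕ →₀ ℕ, g < codimW d ∧ p = monomial d (1 : ℚ) }

def Fil1Rg (g : ℕ) : Submodule ℚ (MvPolynomial ℕ ℚ) :=
  Submodule.span ℚ { p | ∃ d : ℕ →₀ ℕ, codimW d = g ∧ 1 ≤ levelW d ∧ p = monomial d (1 : ℚ) }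

def Ipol (g : ℕ) : Submodule ℚ (MvPolynomial ℕ ℚ) :=
  Rgt g ⊔ ⨆ n : ℕ, Submodule.span ℚ ((Dop g)^[n] '' (Fil1Rg g : Set (MvPolynomial ℕ ℚ)))

def Mij (i j : ℕ) : Submodule ℚ (MvPolynomial ℕ ℚ) :=
  Submodule.span ℚ
    { p | ∃ d : ℕ →₀ ℕ, d 0 = 0 ∧ codimW d = i ∧ levelW d = j ∧ p = monomial d (1 : ℚ) }

/-- The multiplicity `μ(i,j) = dim_ℚ( M^i_{(j)} / 𝒟^{g−2i+j+1}(M^{g−i+j+1}_{(j)}) )`. -/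
def muIJ (g i j : ℕ) : ℕ :=
  Module.finrank ℚ
    (↥(Mij i j) ⧸
      (Submodule.span ℚ
        ((Dop g)^[g + j + 1 - 2 * i] ''
          (Mij (g + j + 1 - i) j : Set (MvPolynomial ℕ ℚ)))).comap (Mij i j).subtype)

/-- Model of the irreducible sl₂-module `V(n) = Symⁿ(standard)`: coordinates with
respect to a basis `b_0, …, b_n` with `h b_k = (n-2k) b_k`, `e b_k = (n-k+1) b_{k-1}`,
`f b_k = (k+1) b_{k+1}`. -/
def eV (n : ℕ) (v : Fin (n + 1) → ℚ) : Fin (n + 1) → ℚ :=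
  fun k => if h : (k : ℕ) + 1 < n + 1 then ((n : ℚ) - (k : ℕ)) * v ⟨(k : ℕ) + 1, h⟩ else 0

def fV (n : ℕ) (v : Fin (n + 1) → ℚ) : Fin (n + 1) → ℚ :=
  fun k => ((k : ℕ) : ℚ) * v ⟨(k : ℕ) - 1, by omega⟩

def hV (n : ℕ) (v : Fin (n + 1) → ℚ) : Fin (n + 1) → ℚ :=
  fun k => ((n : ℚ) - 2 * (k : ℕ)) * v k

/-- Index range `j ≤ i ≤ min(g−1, 2j, ⌊(g+j)/2⌋)` for the direct sum. -/
def idxSet (g j : ℕ) : Finset ℕ := Finset.Icc j (min (g - 1) (min (2 * j) ((g + j) / 2)))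

/-- The target sl₂-module `⊕_{i} V(g−2i+j)^{⊕μ(i,j)}`. -/
def Tspace (g j : ℕ) : Type :=
  (i : idxSet g j) → Fin (muIJ g (i : ℕ) j) → Fin (g + j - 2 * (i : ℕ) + 1) → ℚ

instance (g j : ℕ) : AddCommGroup (Tspace g j) := by unfold Tspace; infer_instance
instance (g j : ℕ) : Module ℚ (Tspace g j) := by unfold Tspace; infer_instance

def eT (g j : ℕ) (v : Tspace g j) : Tspace g j :=
  fun i m => eV (g + j - 2 * (i : ℕ)) (v i m)
def fT (g j : ℕ) (v : Tspace g j) : Tspace g j :=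
  fun i m => fV (g + j - 2 * (i : ℕ)) (v i m)
def hT (g j : ℕ) (v : Tspace g j) : Tspace g j :=
  fun i m => hV (g + j - 2 * (i : ℕ)) (v i m)

/-- `Dop` with the range of summation cut at `N`. -/
def truncD (g N : ℕ) : MvPolynomial ℕ ℚ →ₗ[ℚ] MvPolynomial ℕ ℚ :=
  -(g : ℚ) • (pderiv (R := ℚ) 0).toLinearMap +
    (1/2 : ℚ) • ∑ a ∈ Finset.range N, ∑ b ∈ Finset.range N,
      ((a + b + 2).choose (b + 1) : ℚ) •
        (LinearMap.mulLeft ℚ (X (a + b)) ∘ₗ (pderiv a).toLinearMap ∘ₗ (pderiv b).toLinearMap)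

lemma truncD_apply (g N : ℕ) (p : MvPolynomial ℕ ℚ) :
    truncD g N p = -(g : ℚ) • pderiv 0 p + (1/2 : ℚ) • ∑ a ∈ Finset.range N,
      ∑ b ∈ Finset.range N, ((a + b + 2).choose (b + 1) : ℚ) •
        (X (a + b) * pderiv a (pderiv b p)) := by
  simp [truncD, LinearMap.sum_apply]

lemma pderiv_comm' (a b : ℕ) (p : MvPolynomial ℕ ℚ) :
    pderiv a (pderiv b p) = pderiv b (pderiv a p) := by
  have h : ⁅pderiv (R := ℚ) a, pderiv (R := ℚ) b⁆ = 0 := by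
    refine MvPolynomial.derivation_ext fun i => ?_
    rw [Derivation.commutator_apply, pderiv_X, pderiv_X]
    simp [Pi.single_apply, apply_ite]
  have := congrArg (fun D => D p) h
  simpa [Derivation.commutator_apply, sub_eq_zero] using this

lemma pderiv_eq_zero_of_vars_sup_lt {p : MvPolynomial ℕ ℚ} {a : ℕ} (h : p.vars.sup id < a) :
    pderiv a p = 0 := by
  refine pderiv_eq_zero_of_notMem_vars fun ha => ?_
  have := Finset.le_sup (f := id) ha
  simp only [id] at this
  omega

lemma Dop_eq_truncD (g : ℕ) (p : MvPolynomial ℕ ℚ) {N : ℕ} (hN : p.vars.sup id + 1 ≤ N) :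
    Dop g p = truncD g N p := by
  rw [truncD_apply, Dop]
  have hsub : Finset.range (p.vars.sup id + 1) ⊆ Finset.range N := Finset.range_mono hN
  congr 2
  rw [← Finset.sum_subset hsub]
  · refine Finset.sum_congr rfl fun a _ => Finset.sum_subset hsub fun b _ hb => ?_
    rw [pderiv_eq_zero_of_vars_sup_lt (a := b) (by simpa using hb)]
    simp
  · intro a _ ha
    refine Finset.sum_eq_zero fun b _ => ?_
    rw [pderiv_comm', pderiv_eq_zero_of_vars_sup_lt (a := a) (by simpa using ha)]
    simp

/-- `Dop` as a linear map. -/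
def linD (g : ℕ) : Module.End ℚ (MvPolynomial ℕ ℚ) where
  toFun := Dop g
  map_add' p q := by
    set N := (p.vars.sup id + 1) + (q.vars.sup id + 1) + ((p + q).vars.sup id + 1)
    rw [Dop_eq_truncD g p (N := N) (by omega), Dop_eq_truncD g q (N := N) (by omega),
      Dop_eq_truncD g (p + q) (N := N) (by omega), map_add]
  map_smul' c p := by
    set N := (p.vars.sup id + 1) + ((c • p).vars.sup id + 1)
    rw [Dop_eq_truncD g p (N := N) (by omega), Dop_eq_truncD g (c • p) (N := N) (by omega),
      map_smul, RingHom.id_apply]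

lemma linD_apply (g : ℕ) (p : MvPolynomial ℕ ℚ) : linD g p = Dop g p := rfl

lemma linD_pow_apply (g n : ℕ) (p : MvPolynomial ℕ ℚ) : (linD g ^ n) p = (Dop g)^[n] p := by
  rw [Module.End.pow_apply]; rfl

/-- The bidegree (codimension, level) of a variable. -/
def biW : ℕ → ℤ × ℤ := fun v => ((v : ℤ) + 1, (v : ℤ))

/-- `R^i_{(j)}` with integer indices. -/
def homog (i j : ℤ) : Submodule ℚ (MvPolynomial ℕ ℚ) := weightedHomogeneousSubmodule ℚ biW (i, j)

lemma weight_biW (d : ℕ →₀ ℕ) : Finsupp.weight biW d = ((codimW d : ℤ), (levelW d : ℤ)) := by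
  rw [Finsupp.weight_apply]
  ext
  · simp [Finsupp.sum, codimW, biW, Prod.fst_sum, mul_comm]
  · simp [Finsupp.sum, levelW, biW, Prod.snd_sum, mul_comm]

lemma monomial_mem_homog {d : ℕ →₀ ℕ} {i j : ℤ} (hi : (codimW d : ℤ) = i)
    (hj : (levelW d : ℤ) = j) (c : ℚ) : monomial d c ∈ homog i j :=
  isWeightedHomogeneous_monomial _ _ _ (by rw [weight_biW, hi, hj])

lemma homog_support {i j : ℤ} {p : MvPolynomial ℕ ℚ} (hp : p ∈ homog i j) {d : ℕ →₀ ℕ}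
    (hd : d ∈ p.support) : (codimW d : ℤ) = i ∧ (levelW d : ℤ) = j := by
  have := hp (mem_support_iff.1 hd)
  rw [weight_biW] at this
  exact Prod.ext_iff.1 this

lemma mem_of_monomials_mem {S : Submodule ℚ (MvPolynomial ℕ ℚ)} {p : MvPolynomial ℕ ℚ}
    (h : ∀ d ∈ p.support, monomial d (1 : ℚ) ∈ S) : p ∈ S := by
  rw [p.as_sum]
  refine S.sum_mem fun d hd => ?_
  have : monomial d (coeff d p) = coeff d p • monomial d (1 : ℚ) := by simp [smul_monomial]
  rw [this]
  exact S.smul_mem _ (h d hd)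

lemma Rij_eq_homog (i j : ℕ) : Rij i j = homog i j := by
  apply le_antisymm
  · refine Submodule.span_le.2 ?_
    rintro _ ⟨d, hi, hj, rfl⟩
    exact monomial_mem_homog (by simp [hi]) (by simp [hj]) _
  · intro p hp
    refine mem_of_monomials_mem fun d hd => Submodule.subset_span ⟨d, ?_, ?_, rfl⟩
    · exact_mod_cast (homog_support hp hd).1
    · exact_mod_cast (homog_support hp hd).2

lemma homog_eq_zero_of_forall {i j : ℤ} {p : MvPolynomial ℕ ℚ} (hp : p ∈ homog i j)
    (h : ∀ d : ℕ →₀ ℕ, (codimW d : ℤ) = i → (levelW d : ℤ) = j → False) : p = 0 := by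
  rw [← support_eq_empty, Finset.eq_empty_iff_forall_notMem]
  intro d hd
  exact h d (homog_support hp hd).1 (homog_support hp hd).2

lemma X_mul_mem_homog {i j : ℤ} {p : MvPolynomial ℕ ℚ} (v : ℕ) (hp : p ∈ homog i j) :
    X v * p ∈ homog (i + v + 1) (j + v) := by
  have := (isWeightedHomogeneous_X ℚ biW v).mul hp
  change IsWeightedHomogeneous biW (X v * p) (i + v + 1, j + v)
  convert this using 1
  ext <;> simp [biW] <;> ring

lemma X_zero_mul_mem_homog {i j : ℤ} {p : MvPolynomial ℕ ℚ} (hp : p ∈ homog i j) :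
    X 0 * p ∈ homog (i + 1) j := by
  simpa using X_mul_mem_homog 0 hp

lemma pderiv_mem_homog {i j : ℤ} {p : MvPolynomial ℕ ℚ} (v : ℕ) (hp : p ∈ homog i j) :
    pderiv v p ∈ homog (i - v - 1) (j - v) :=
  IsWeightedHomogeneous.pderiv hp (by simp [biW])

lemma linD_mem_homog (g : ℕ) {i j : ℤ} {p : MvPolynomial ℕ ℚ} (hp : p ∈ homog i j) :
    linD g p ∈ homog (i - 1) j := by
  rw [linD_apply, Dop_eq_truncD g p le_rfl, truncD_apply]
  refine Submodule.add_mem _ (Submodule.smul_mem _ _ ?_) (Submodule.smul_mem _ _ <|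
    Submodule.sum_mem _ fun a _ => Submodule.sum_mem _ fun b _ => Submodule.smul_mem _ _ ?_)
  · simpa using pderiv_mem_homog 0 hp
  · have := X_mul_mem_homog (a + b) (pderiv_mem_homog a (pderiv_mem_homog b hp))
    rw [show i - 1 = i - b - 1 - a - 1 + ((a + b : ℕ) : ℤ) + 1 by push_cast; ring,
      show j = j - b - a + ((a + b : ℕ) : ℤ) by push_cast; ring]
    exact this

lemma linD_pow_mem_homog (g n : ℕ) {i j : ℤ} {p : MvPolynomial ℕ ℚ} (hp : p ∈ homog i j) :
    (linD g ^ n) p ∈ homog (i - n) j := by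
  induction n with
  | zero => simpa using hp
  | succ n ih =>
    rw [pow_succ', Module.End.mul_apply,
      show i - ((n + 1 : ℕ) : ℤ) = i - n - 1 by push_cast; ring]
    exact linD_mem_homog g ih

lemma pderiv_zero_truncD (g N : ℕ) {p : MvPolynomial ℕ ℚ} (hp : pderiv 0 p = 0) :
    pderiv 0 (truncD g N p) = 0 := by
  rw [truncD_apply, hp]
  simp only [smul_zero, zero_add, Derivation.map_smul, map_sum]
  rw [Finset.sum_eq_zero, smul_zero]
  refine fun a _ => Finset.sum_eq_zero fun b _ => ?_
  have h0 : ∀ c, pderiv 0 (pderiv c p) = 0 := fun c => by rw [pderiv_comm', hp, map_zero]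
  rw [pderiv_mul, pderiv_comm' 0 a, h0 b]
  rcases Nat.eq_zero_or_pos (a + b) with h | h
  · obtain ⟨rfl, rfl⟩ : a = 0 ∧ b = 0 := by omega
    simp [hp]
  · rw [pderiv_X_of_ne (by omega)]
    simp

lemma pderiv_zero_linD_pow (g n : ℕ) {p : MvPolynomial ℕ ℚ} (hp : pderiv 0 p = 0) :
    pderiv 0 ((linD g ^ n) p) = 0 := by
  induction n with
  | zero => simpa using hp
  | succ n ih =>
    rw [pow_succ', Module.End.mul_apply, linD_apply, Dop_eq_truncD g _ le_rfl]
    exact pderiv_zero_truncD _ _ ih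

lemma Mij_eq (i j : ℕ) : Mij i j = homog i j ⊓ LinearMap.ker (pderiv 0).toLinearMap := by
  apply le_antisymm
  · refine Submodule.span_le.2 ?_
    rintro _ ⟨d, h0, hi, hj, rfl⟩
    refine ⟨monomial_mem_homog (by simp [hi]) (by simp [hj]) _, ?_⟩
    simp [pderiv_monomial, h0]
  · rintro p ⟨hp, hp0⟩
    refine mem_of_monomials_mem fun d hd => Submodule.subset_span ⟨d, ?_, ?_, ?_, rfl⟩
    · by_contra h
      have hc : coeff (d - Finsupp.single 0 1) (pderiv 0 p) = 0 := by
        have : pderiv 0 p = 0 := hp0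
        simp [this]
      have hle : Finsupp.single 0 1 ≤ d := by
        rw [Finsupp.single_le_iff]; omega
      rw [coeff_pderiv, tsub_add_cancel_of_le hle] at hc
      rcases mul_eq_zero.1 hc with hc | hc
      · exact (mem_support_iff.1 hd) hc
      · norm_cast at hc
    · exact_mod_cast (homog_support hp hd).1
    · exact_mod_cast (homog_support hp hd).2

lemma Mij_le_homog (i j : ℕ) : Mij i j ≤ homog i j := by
  rw [Mij_eq]; exact inf_le_left

lemma linD_pow_mem_Mij (g n : ℕ) {i j : ℕ} {p : MvPolynomial ℕ ℚ} (hp : p ∈ Mij (i + n) j) :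
    (linD g ^ n) p ∈ Mij i j := by
  rw [Mij_eq] at hp ⊢
  refine ⟨?_, pderiv_zero_linD_pow g n hp.2⟩
  simpa using linD_pow_mem_homog g n hp.1

lemma euler_monomial (d : ℕ →₀ ℕ) {N : ℕ} (hN : d.support ⊆ Finset.range N) :
    ∑ a ∈ Finset.range N, ((a : ℚ) + 2) • (X a * pderiv a (monomial d (1 : ℚ))) =
      (2 * (codimW d : ℚ) - levelW d) • monomial d (1 : ℚ) := by
  have h1 : (codimW d : ℚ) = ∑ a ∈ Finset.range N, ((a : ℚ) + 1) * d a := by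
    rw [codimW, Finsupp.sum_of_support_subset d hN _ (by simp)]; push_cast; rfl
  have h2 : (levelW d : ℚ) = ∑ a ∈ Finset.range N, (a : ℚ) * d a := by
    rw [levelW, Finsupp.sum_of_support_subset d hN _ (by simp)]; push_cast; rfl
  rw [h1, h2, Finset.mul_sum, ← Finset.sum_sub_distrib, Finset.sum_smul]
  refine Finset.sum_congr rfl fun a _ => ?_
  rw [X_mul_pderiv_monomial, ← Nat.cast_smul_eq_nsmul ℚ, smul_smul]
  congr 1
  ring

lemma truncD_X_zero_mul (g N : ℕ) (hN : 0 < N) (p : MvPolynomial ℕ ℚ) :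
    truncD g N (X 0 * p) = X 0 * truncD g N p - (g : ℚ) • p +
      ∑ a ∈ Finset.range N, ((a : ℚ) + 2) • (X a * pderiv a p) := by
  have key : ∀ a b : ℕ, pderiv a (pderiv b (X 0 * p)) =
      (if b = 0 then pderiv a p else 0) + (if a = 0 then pderiv b p else 0) +
        X 0 * pderiv a (pderiv b p) := by
    intro a b
    have hX : ∀ c : ℕ, pderiv c (X 0 : MvPolynomial ℕ ℚ) = if c = 0 then 1 else 0 := by
      intro c
      rw [pderiv_X, Pi.single_apply]
      simp [eq_comm]
    rw [pderiv_mul, map_add, hX, pderiv_mul, pderiv_mul, hX]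
    split_ifs <;> simp [add_assoc]
  have h0 : (0 : ℕ) ∈ Finset.range N := Finset.mem_range.2 hN
  have hA : ∑ a ∈ Finset.range N, ∑ b ∈ Finset.range N,
      ((a + b + 2).choose (b + 1) : ℚ) • (X (a + b) * (if b = 0 then pderiv a p else 0)) =
      ∑ a ∈ Finset.range N, ((a : ℚ) + 2) • (X a * pderiv a p) := by
    refine Finset.sum_congr rfl fun a _ => ?_
    rw [Finset.sum_eq_single_of_mem 0 h0 (fun b _ hb => by simp [hb])]
    simp
  have hB : ∑ a ∈ Finset.range N, ∑ b ∈ Finset.range N,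
      ((a + b + 2).choose (b + 1) : ℚ) • (X (a + b) * (if a = 0 then pderiv b p else 0)) =
      ∑ a ∈ Finset.range N, ((a : ℚ) + 2) • (X a * pderiv a p) := by
    rw [Finset.sum_eq_single_of_mem 0 h0 (fun b _ hb => by simp [hb])]
    refine Finset.sum_congr rfl fun b _ => ?_
    have : (0 + b + 2).choose (b + 1) = b + 2 := by
      rw [zero_add]; exact Nat.choose_succ_self_right (b + 1)
    rw [this]
    simp
  have hC : ∑ a ∈ Finset.range N, ∑ b ∈ Finset.range N,
      ((a + b + 2).choose (b + 1) : ℚ) • (X (a + b) * (X 0 * pderiv a (pderiv b p))) =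
      X 0 * ∑ a ∈ Finset.range N, ∑ b ∈ Finset.range N,
      ((a + b + 2).choose (b + 1) : ℚ) • (X (a + b) * pderiv a (pderiv b p)) := by
    simp only [Finset.mul_sum, mul_smul_comm]
    refine Finset.sum_congr rfl fun a _ => Finset.sum_congr rfl fun b _ => ?_
    rw [mul_left_comm]
  rw [truncD_apply, truncD_apply]
  simp only [key, mul_add, smul_add, Finset.sum_add_distrib]
  rw [hA, hB, hC, pderiv_mul, pderiv_X_self]
  have half : ∀ q : MvPolynomial ℕ ℚ, (1/2 : ℚ) • q + (1/2 : ℚ) • q = q := fun q => by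
    rw [← add_smul]; norm_num
  rw [half]
  simp only [mul_smul_comm, mul_neg, smul_add, one_mul, neg_smul]
  abel

lemma linD_X_zero_mul (g : ℕ) {i j : ℤ} {p : MvPolynomial ℕ ℚ} (hp : p ∈ homog i j) :
    linD g (X 0 * p) = X 0 * linD g p + ((2 * i - j - g : ℤ) : ℚ) • p := by
  suffices h : p ∈ LinearMap.ker (linD g ∘ₗ LinearMap.mulLeft ℚ (X 0) -
      LinearMap.mulLeft ℚ (X 0) ∘ₗ linD g - ((2 * i - j - g : ℤ) : ℚ) • LinearMap.id) by
    have h' : linD g (X 0 * p) - X 0 * linD g p - ((2 * i - j - g : ℤ) : ℚ) • p = 0 := by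
      simpa using h
    rw [sub_sub, sub_eq_zero] at h'
    exact h'
  refine mem_of_monomials_mem fun d hd => ?_
  obtain ⟨hi, hj⟩ := homog_support hp hd
  set m := monomial d (1 : ℚ)
  have : linD g (X 0 * m) = X 0 * linD g m + ((2 * i - j - g : ℤ) : ℚ) • m := by
    set N := (m.vars.sup id + 1) + ((X 0 * m).vars.sup id + 1) + (d.support.sup id + 1) with hNdef
    rw [linD_apply, linD_apply, Dop_eq_truncD g m (N := N) (by omega),
      Dop_eq_truncD g (X 0 * m) (N := N) (by omega), truncD_X_zero_mul _ _ (by omega),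
      euler_monomial d (N := N), ← hi, ← hj, sub_add, sub_eq_add_neg, add_right_inj, ← sub_smul,
      ← neg_smul]
    · congr 1
      push_cast
      ring
    · intro a ha
      have := Finset.le_sup (f := id) ha
      simp only [id] at this
      rw [Finset.mem_range]
      omega
  simp [this]

lemma linD_pow_X_zero_mul (g n : ℕ) {i j : ℤ} {p : MvPolynomial ℕ ℚ} (hp : p ∈ homog i j) :
    (linD g ^ (n + 1)) (X 0 * p) = X 0 * (linD g ^ (n + 1)) p +
      (((n + 1) * (2 * i - j - g - n) : ℤ) : ℚ) • (linD g ^ n) p := by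
  induction n with
  | zero => simpa using linD_X_zero_mul g hp
  | succ n ih =>
    rw [pow_succ', Module.End.mul_apply, ih, map_add, map_smul,
      linD_X_zero_mul g (linD_pow_mem_homog g (n + 1) hp), ← Module.End.mul_apply,
      ← Module.End.mul_apply, ← pow_succ', ← pow_succ', add_assoc, ← add_smul]
    congr 2
    push_cast
    ring

lemma homog_eq_zero_of_neg {i j : ℤ} (hi : i < 0) {p : MvPolynomial ℕ ℚ} (hp : p ∈ homog i j) :
    p = 0 :=
  homog_eq_zero_of_forall hp fun d hd _ => by omega

lemma eq_single_of_levelW_eq_zero {d : ℕ →₀ ℕ} (h : levelW d = 0) :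
    d = Finsupp.single 0 (codimW d) := by
  have hd : d = Finsupp.single 0 (d 0) := by
    ext v
    rcases Nat.eq_zero_or_pos v with rfl | hv
    · simp
    · rw [Finsupp.single_eq_of_ne (by omega)]
      by_contra hne
      have := (Finset.sum_eq_zero_iff.1 h) v (Finsupp.mem_support_iff.2 hne)
      rcases Nat.mul_eq_zero.1 this with h | h <;> omega
  have hc : codimW d = d 0 := by
    rw [hd]; simp [codimW]
  rw [hc]; exact hd

lemma linD_X_zero_pow (g n : ℕ) : linD g (X 0 ^ (n + 1)) =
    ((n + 1 : ℚ) * (n - g)) • (X 0 ^ n : MvPolynomial ℕ ℚ) := by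
  have hpow : ∀ k : ℕ, (X 0 ^ k : MvPolynomial ℕ ℚ) ∈ homog k 0 := by
    intro k
    rw [X_pow_eq_monomial]
    exact monomial_mem_homog (by simp [codimW]) (by simp [levelW]) _
  induction n with
  | zero =>
    have h1 : linD g (X 0 ^ 0) = 0 :=
      homog_eq_zero_of_neg (by simp) (linD_mem_homog g (hpow 0))
    rw [pow_succ', linD_X_zero_mul g (hpow 0), h1]
    simp
  | succ n ih =>
    rw [pow_succ', linD_X_zero_mul g (hpow (n + 1)), ih, mul_smul_comm, ← pow_succ', ← add_smul]
    congr 1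
    push_cast
    ring

lemma homog_le_Rgt {g : ℕ} {i j : ℤ} (hi : g < i) : homog i j ≤ Rgt g := fun p hp =>
  mem_of_monomials_mem fun d hd => Submodule.subset_span
    ⟨d, by have := (homog_support hp hd).1; omega, rfl⟩

lemma homog_le_Fil1Rg {g : ℕ} {j : ℤ} (hj : 1 ≤ j) : homog g j ≤ Fil1Rg g := fun p hp =>
  mem_of_monomials_mem fun d hd => Submodule.subset_span
    ⟨d, by have := (homog_support hp hd).1; omega, by have := (homog_support hp hd).2; omega, rfl⟩

lemma Rgt_le_Ipol (g : ℕ) : Rgt g ≤ Ipol g := le_sup_left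

lemma linD_pow_mem_Ipol_of_mem_Fil1Rg {g : ℕ} (n : ℕ) {p : MvPolynomial ℕ ℚ} (hp : p ∈ Fil1Rg g) :
    (linD g ^ n) p ∈ Ipol g := by
  refine le_sup_right (a := Rgt g) (Submodule.mem_iSup_of_mem n (Submodule.subset_span ⟨p, hp, ?_⟩))
  rw [linD_pow_apply]

lemma Ipol_le {g : ℕ} {S : Submodule ℚ (MvPolynomial ℕ ℚ)}
    (h₁ : ∀ d : ℕ →₀ ℕ, g < codimW d → monomial d (1 : ℚ) ∈ S)
    (h₂ : ∀ (n : ℕ) (d : ℕ →₀ ℕ), codimW d = g → 1 ≤ levelW d →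
      (linD g ^ n) (monomial d (1 : ℚ)) ∈ S) : Ipol g ≤ S := by
  refine sup_le (Submodule.span_le.2 ?_) (iSup_le fun n => Submodule.span_le.2 ?_)
  · rintro _ ⟨d, hd, rfl⟩
    exact h₁ d hd
  · rintro _ ⟨p, hp, rfl⟩
    rw [← linD_pow_apply]
    have : Fil1Rg g ≤ S.comap (linD g ^ n) := by
      refine Submodule.span_le.2 ?_
      rintro _ ⟨d, hd, hd', rfl⟩
      exact h₂ n d hd hd'
    exact this hp

lemma homog_le_Ipol {g : ℕ} {i j : ℤ} (hi : g ≤ i) (hj : 1 ≤ j) : homog i j ≤ Ipol g := by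
  rcases hi.lt_or_eq with h | rfl
  · exact (homog_le_Rgt h).trans (Rgt_le_Ipol g)
  · exact fun p hp => linD_pow_mem_Ipol_of_mem_Fil1Rg 0 (homog_le_Fil1Rg hj hp)

lemma linD_mem_Ipol {g : ℕ} {p : MvPolynomial ℕ ℚ} (hp : p ∈ Ipol g) : linD g p ∈ Ipol g := by
  suffices h : Ipol g ≤ (Ipol g).comap (linD g) from h hp
  refine Ipol_le (fun d hd => ?_) (fun n d hd hd' => ?_)
  · have hm := linD_mem_homog g (monomial_mem_homog (d := d) rfl rfl 1)
    rcases Nat.eq_zero_or_pos (levelW d) with hl | hl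
    · rw [Submodule.mem_comap]
      rcases Nat.lt_or_ge (g + 1) (codimW d) with h | h
      · exact Rgt_le_Ipol g (homog_le_Rgt (by omega) hm)
      · have hc : codimW d = g + 1 := by omega
        rw [eq_single_of_levelW_eq_zero hl, hc, ← X_pow_eq_monomial, linD_X_zero_pow]
        simp
    · exact homog_le_Ipol (by omega) (by omega) hm
  · rw [Submodule.mem_comap, ← Module.End.mul_apply, ← pow_succ']
    exact linD_pow_mem_Ipol_of_mem_Fil1Rg _ (Submodule.subset_span ⟨d, hd, hd', rfl⟩)

lemma linD_pow_mem_Ipol {g : ℕ} (n : ℕ) {p : MvPolynomial ℕ ℚ} (hp : p ∈ Ipol g) :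
    (linD g ^ n) p ∈ Ipol g := by
  induction n with
  | zero => simpa using hp
  | succ n ih =>
    rw [pow_succ', Module.End.mul_apply]
    exact linD_mem_Ipol ih

lemma X_zero_mul_mem_Ipol {g : ℕ} {p : MvPolynomial ℕ ℚ} (hp : p ∈ Ipol g) :
    X 0 * p ∈ Ipol g := by
  suffices h : Ipol g ≤ (Ipol g).comap (LinearMap.mulLeft ℚ (X 0)) from h hp
  have key : ∀ d : ℕ →₀ ℕ, g ≤ codimW d → X 0 * monomial d (1 : ℚ) ∈ Ipol g := fun d hd =>
    Rgt_le_Ipol g (homog_le_Rgt (by omega)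
      (X_zero_mul_mem_homog (monomial_mem_homog (d := d) rfl rfl 1)))
  refine Ipol_le (fun d hd => key d hd.le) (fun n d hd hd' => ?_)
  rw [Submodule.mem_comap, LinearMap.mulLeft_apply]
  cases n with
  | zero => exact key d hd.ge
  | succ n =>
    have h := linD_pow_X_zero_mul g n (monomial_mem_homog (d := d) rfl rfl 1)
    rw [← sub_eq_iff_eq_add] at h
    rw [← h]
    exact sub_mem (linD_pow_mem_Ipol _ (key d hd.ge)) (Submodule.smul_mem _ _
      (linD_pow_mem_Ipol_of_mem_Fil1Rg _ (Submodule.subset_span ⟨d, hd, hd', rfl⟩)))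

lemma mem_Ipol_of_smul_mem {g : ℕ} {c : ℚ} (hc : c ≠ 0) {p : MvPolynomial ℕ ℚ}
    (h : c • p ∈ Ipol g) : p ∈ Ipol g :=
  (Submodule.smul_mem_iff _ hc).1 h

/-- Modulo `Ipol`, the operator `𝒟 ∘ x₁` has no eigenvalue `c ≥ 0` on a negative weight space. -/
lemma mem_Ipol_of_weight_neg {g : ℕ} {j : ℤ} (n : ℕ) : ∀ {i : ℤ} {c : ℚ} {p : MvPolynomial ℕ ℚ},
    i < n → 2 * i - j - g < 0 → 0 ≤ c → p ∈ homog i j → linD g (X 0 * p) - c • p ∈ Ipol g →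
    p ∈ Ipol g := by
  induction n with
  | zero =>
    intro i c p hi _ _ hp _
    rw [homog_eq_zero_of_neg (by simpa using hi) hp]
    exact zero_mem _
  | succ n ih =>
    intro i c p hi hw hc hp h
    have hw' : ((2 * i - j - g : ℤ) : ℚ) < 0 := by exact_mod_cast hw
    set w : ℚ := ((2 * i - j - g : ℤ) : ℚ)
    have h1 : X 0 * linD g p - (c - w) • p ∈ Ipol g := by
      rw [linD_X_zero_mul g hp] at h
      convert h using 1
      rw [sub_smul]
      abel
    have h2 : linD g p ∈ Ipol g := by
      refine ih (i := i - 1) (c := c - w) (by push_cast at hi; omega) (by omega) (by linarith)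
        (linD_mem_homog g hp) ?_
      simpa using linD_mem_Ipol h1
    refine mem_Ipol_of_smul_mem (c := c - w) (by linarith) ?_
    have := sub_mem (X_zero_mul_mem_Ipol h2) h1
    simpa using this

/-- Modulo `Ipol`, the operator `x₁ ∘ 𝒟` has no eigenvalue `c ≥ 0` on a positive weight space. -/
lemma mem_Ipol_of_weight_pos {g : ℕ} {j : ℤ} (n : ℕ) : ∀ {i : ℤ} {c : ℚ} {p : MvPolynomial ℕ ℚ},
    g < i + n → 0 < 2 * i - j - g → 0 ≤ c → p ∈ homog i j → X 0 * linD g p - c • p ∈ Ipol g →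
    p ∈ Ipol g := by
  induction n with
  | zero =>
    intro i c p hi _ _ hp _
    exact Rgt_le_Ipol g (homog_le_Rgt (by simpa using hi) hp)
  | succ n ih =>
    intro i c p hi hw hc hp h
    have hw' : 0 < ((2 * i - j - g : ℤ) : ℚ) := by exact_mod_cast hw
    set w : ℚ := ((2 * i - j - g : ℤ) : ℚ)
    have h1 : linD g (X 0 * p) - (c + w) • p ∈ Ipol g := by
      rw [linD_X_zero_mul g hp]
      convert h using 1
      rw [add_smul]
      abel
    have h2 : X 0 * p ∈ Ipol g := by
      refine ih (i := i + 1) (c := c + w) (by push_cast at hi; omega) (by omega) (by linarith)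
        (X_zero_mul_mem_homog hp) ?_
      simpa [mul_sub] using X_zero_mul_mem_Ipol h1
    refine mem_Ipol_of_smul_mem (c := c + w) (by linarith) ?_
    have := sub_mem (linD_mem_Ipol h2) h1
    simpa using this

lemma linD_pow_mem_sup {g : ℕ} {i j : ℤ} (n : ℕ) : ∀ {m : ℕ} {p : MvPolynomial ℕ ℚ},
    g < i + m + n → 0 < 2 * i + m - j - g → p ∈ homog (i + m) j →
    (linD g ^ m) p ∈ Ipol g ⊔ (homog (i - 1) j).map (LinearMap.mulLeft ℚ (X 0)) := by
  induction n with
  | zero =>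
    intro m p hm _ hp
    exact le_sup_left (a := Ipol g)
      (linD_pow_mem_Ipol m (Rgt_le_Ipol g (homog_le_Rgt (by simpa using hm) hp)))
  | succ n ih =>
    intro m p hm hw hp
    have h1 := ih (m := m + 1) (p := X 0 * p) (by push_cast at hm ⊢; omega)
      (by push_cast; omega) (by
        rw [show i + ((m + 1 : ℕ) : ℤ) = i + m + 1 by push_cast; ring]
        exact X_zero_mul_mem_homog hp)
    rw [linD_pow_X_zero_mul g m hp] at h1
    have h2 : X 0 * (linD g ^ (m + 1)) p ∈
        Ipol g ⊔ (homog (i - 1) j).map (LinearMap.mulLeft ℚ (X 0)) := by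
      refine le_sup_right (a := Ipol g) ⟨_, ?_, rfl⟩
      have := linD_pow_mem_homog g (m + 1) hp
      rwa [show i + m - ((m + 1 : ℕ) : ℤ) = i - 1 by push_cast; ring] at this
    rw [Submodule.add_mem_iff_right _ h2] at h1
    refine (Submodule.smul_mem_iff _ ?_).1 h1
    have : (0 : ℤ) < (m + 1) * (2 * (i + m) - j - g - m) := mul_pos (by omega) (by omega)
    exact_mod_cast this.ne'

lemma codimW_eq (d : ℕ →₀ ℕ) : codimW d = levelW d + d.sum fun _ e => e := by
  simp only [codimW, levelW, Finsupp.sum, ← Finset.sum_add_distrib, add_mul, one_mul]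

lemma levelW_lt_codimW {d : ℕ →₀ ℕ} (h : 1 ≤ levelW d) : levelW d < codimW d := by
  rw [codimW_eq]
  refine Nat.lt_add_of_pos_right (Nat.pos_of_ne_zero fun h0 => ?_)
  have : d = 0 := by
    ext v
    by_contra hv
    exact hv (Finset.sum_eq_zero_iff.1 h0 v (Finsupp.mem_support_iff.2 hv))
  simp [this, levelW] at h

lemma codimW_le_two_mul_levelW {d : ℕ →₀ ℕ} (h : d 0 = 0) : codimW d ≤ 2 * levelW d := by
  simp only [codimW, levelW, Finsupp.sum, Finset.mul_sum]
  refine Finset.sum_le_sum fun v hv => ?_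
  have hv0 : v ≠ 0 := by
    rintro rfl
    exact (Finsupp.mem_support_iff.1 hv) h
  rw [← mul_assoc]
  exact Nat.mul_le_mul_right _ (by omega)

lemma finite_codimW_eq (i : ℕ) : {d : ℕ →₀ ℕ | codimW d = i}.Finite := by
  refine ((Finset.range i).finsupp fun _ => Finset.range (i + 1)).finite_toSet.subset ?_
  intro d hd
  have hle : ∀ v ∈ d.support, (v + 1) * d v ≤ i := fun v hv => by
    rw [← show codimW d = i from hd]
    exact Finset.single_le_sum (f := fun v => (v + 1) * d v) (fun _ _ => Nat.zero_le _) hv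
  have hpos : ∀ v ∈ d.support, 0 < d v := fun v hv =>
    Nat.pos_of_ne_zero (Finsupp.mem_support_iff.1 hv)
  rw [Finset.mem_coe, Finset.mem_finsupp_iff]
  refine ⟨fun v hv => ?_, fun v _ => ?_⟩
  · have := hle v hv
    have := Nat.le_mul_of_pos_right (v + 1) (hpos v hv)
    rw [Finset.mem_range]; omega
  · rw [Finset.mem_range]
    by_cases hv : v ∈ d.support
    · have := hle v hv
      have := Nat.le_mul_of_pos_left (d v) (Nat.succ_pos v)
      simp only [Nat.succ_eq_add_one] at this
      omega
    · rw [Finsupp.notMem_support_iff.1 hv]; omega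

instance finiteDimensional_Mij (i j : ℕ) : FiniteDimensional ℚ (Mij i j) := by
  refine FiniteDimensional.span_of_finite ℚ
    (((finite_codimW_eq i).image fun d => monomial d (1 : ℚ)).subset ?_)
  rintro _ ⟨d, _, hd, _, rfl⟩
  exact ⟨d, hd, rfl⟩

/-- The projection of `R` onto `M^i_{(j)}` that annihilates all other monomials. -/
def projM (i j : ℕ) : MvPolynomial ℕ ℚ →ₗ[ℚ] MvPolynomial ℕ ℚ :=
  (basisMonomials ℕ ℚ).constr ℚ fun d =>
    if d 0 = 0 ∧ codimW d = i ∧ levelW d = j then monomial d 1 else 0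

lemma projM_monomial (i j : ℕ) (d : ℕ →₀ ℕ) : projM i j (monomial d (1 : ℚ)) =
    if d 0 = 0 ∧ codimW d = i ∧ levelW d = j then monomial d 1 else 0 := by
  have := (basisMonomials ℕ ℚ).constr_basis ℚ (fun d : ℕ →₀ ℕ =>
    if d 0 = 0 ∧ codimW d = i ∧ levelW d = j then (monomial d 1 : MvPolynomial ℕ ℚ) else 0) d
  rwa [coe_basisMonomials] at this

lemma projM_mem (i j : ℕ) (p : MvPolynomial ℕ ℚ) : projM i j p ∈ Mij i j := by
  suffices h : p ∈ (Mij i j).comap (projM i j) from h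
  refine mem_of_monomials_mem fun d _ => ?_
  rw [Submodule.mem_comap, projM_monomial]
  split_ifs with h
  · exact Submodule.subset_span ⟨d, h.1, h.2.1, h.2.2, rfl⟩
  · exact zero_mem _

lemma projM_of_mem {i j : ℕ} {p : MvPolynomial ℕ ℚ} (hp : p ∈ Mij i j) : projM i j p = p := by
  have : Mij i j ≤ LinearMap.eqLocus (projM i j) LinearMap.id := by
    refine Submodule.span_le.2 ?_
    rintro _ ⟨d, h0, hi, hj, rfl⟩
    simp [projM_monomial, h0, hi, hj]
  exact this hp

lemma projM_X_zero_mul (i j : ℕ) (p : MvPolynomial ℕ ℚ) : projM i j (X 0 * p) = 0 := by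
  suffices h : p ∈ LinearMap.ker (projM i j ∘ₗ LinearMap.mulLeft ℚ (X 0)) from h
  refine mem_of_monomials_mem fun d _ => ?_
  rw [LinearMap.mem_ker, LinearMap.comp_apply, LinearMap.mulLeft_apply, X, monomial_mul, one_mul,
    projM_monomial, if_neg]
  simp

lemma projM_of_mem_homog {i j : ℕ} {i' j' : ℤ} {p : MvPolynomial ℕ ℚ} (hp : p ∈ homog i' j')
    (h : ¬ (i' = i ∧ j' = j)) : projM i j p = 0 := by
  suffices h : p ∈ LinearMap.ker (projM i j) from h
  refine mem_of_monomials_mem fun d hd => ?_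
  have := homog_support hp hd
  rw [LinearMap.mem_ker, projM_monomial, if_neg]
  omega

lemma sub_projM_mem {i j : ℕ} {p : MvPolynomial ℕ ℚ} (hp : p ∈ homog i j) :
    p - projM i j p ∈ (homog ((i : ℤ) - 1) j).map (LinearMap.mulLeft ℚ (X 0)) := by
  suffices h : p ∈ ((homog ((i : ℤ) - 1) j).map (LinearMap.mulLeft ℚ (X 0))).comap
      (LinearMap.id - projM i j) from h
  refine mem_of_monomials_mem fun d hd => ?_
  obtain ⟨hi, hj⟩ := homog_support hp hd
  rw [Submodule.mem_comap, LinearMap.sub_apply, LinearMap.id_apply, projM_monomial]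
  split_ifs with h
  · simp
  · have h0 : d 0 ≠ 0 := by omega
    have hle : Finsupp.single 0 1 ≤ d := by
      rw [Finsupp.single_le_iff]; omega
    have hX : X 0 * monomial (d - Finsupp.single 0 1) (1 : ℚ) = monomial d 1 := by
      rw [X, monomial_mul, one_mul, add_tsub_cancel_of_le hle]
    refine ⟨monomial (d - Finsupp.single 0 1) 1, ?_, by simp [hX]⟩
    have hw : Finsupp.weight biW d = Finsupp.weight biW (d - Finsupp.single 0 1) + (1, 0) := by
      conv_lhs => rw [← tsub_add_cancel_of_le hle]
      rw [map_add, Finsupp.weight_single]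
      simp [biW]
    rw [weight_biW, weight_biW] at hw
    have hw' := Prod.ext_iff.1 hw
    simp only [Prod.fst_add, Prod.snd_add] at hw'
    exact monomial_mem_homog (by omega) (by omega) _

lemma exists_eq_projM_add {i j : ℕ} {p : MvPolynomial ℕ ℚ} (hp : p ∈ homog i j) :
    ∃ q ∈ homog ((i : ℤ) - 1) j, p = projM i j p + X 0 * q := by
  obtain ⟨q, hq, h⟩ := sub_projM_mem hp
  exact ⟨q, hq, by rw [LinearMap.mulLeft_apply] at h; rw [h]; abel⟩

/-- `𝒟^{g−2i+j+1}(M^{g−i+j+1}_{(j)})` as a subspace of `M^i_{(j)}`. -/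
def relM (g i j : ℕ) : Submodule ℚ (Mij i j) :=
  (Submodule.span ℚ ((Dop g)^[g + j + 1 - 2 * i] ''
    (Mij (g + j + 1 - i) j : Set (MvPolynomial ℕ ℚ)))).comap (Mij i j).subtype

/-- A basis of `M^i_{(j)} / relM g i j`. -/
def quotBasis (g i j : ℕ) : Module.Basis (Fin (muIJ g i j)) ℚ (Mij i j ⧸ relM g i j) :=
  Module.finBasis ℚ (Mij i j ⧸ relM g i j)

/-- The functionals on `R` induced by a basis of the dual of `M^i_{(j)} / relM g i j`. -/
def lam (g i j : ℕ) (m : Fin (muIJ g i j)) : MvPolynomial ℕ ℚ →ₗ[ℚ] ℚ :=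
  (quotBasis g i j).coord m ∘ₗ (relM g i j).mkQ ∘ₗ
    (projM i j).codRestrict (Mij i j) (projM_mem i j)

lemma lam_eq (g i j : ℕ) (m : Fin (muIJ g i j)) (p : MvPolynomial ℕ ℚ) : lam g i j m p =
    (quotBasis g i j).repr
      ((relM g i j).mkQ ⟨projM i j p, projM_mem i j p⟩) m := rfl

lemma lam_of_projM_eq_zero {g i j : ℕ} (m : Fin (muIJ g i j)) {p : MvPolynomial ℕ ℚ}
    (h : projM i j p = 0) : lam g i j m p = 0 := by
  have : (⟨projM i j p, projM_mem i j p⟩ : Mij i j) = 0 := Subtype.ext h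
  rw [lam_eq, this, map_zero, map_zero, Finsupp.zero_apply]

lemma lam_X_zero_mul {g i j : ℕ} (m : Fin (muIJ g i j)) (p : MvPolynomial ℕ ℚ) :
    lam g i j m (X 0 * p) = 0 :=
  lam_of_projM_eq_zero m (projM_X_zero_mul i j p)

lemma lam_of_mem_homog {g i j : ℕ} (m : Fin (muIJ g i j)) {i' j' : ℤ} {p : MvPolynomial ℕ ℚ}
    (hp : p ∈ homog i' j') (h : ¬ (i' = i ∧ j' = j)) : lam g i j m p = 0 :=
  lam_of_projM_eq_zero m (projM_of_mem_homog hp h)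

lemma lam_linD_pow_of_mem_Mij {g i j : ℕ} (m : Fin (muIJ g i j)) (hi : 2 * i ≤ g + j)
    {p : MvPolynomial ℕ ℚ} (hp : p ∈ Mij (g + j + 1 - i) j) :
    lam g i j m ((linD g ^ (g + j + 1 - 2 * i)) p) = 0 := by
  have hmem : (linD g ^ (g + j + 1 - 2 * i)) p ∈ Mij i j := by
    refine linD_pow_mem_Mij g _ ?_
    rwa [show i + (g + j + 1 - 2 * i) = g + j + 1 - i by omega]
  have : (relM g i j).mkQ ⟨projM i j ((linD g ^ (g + j + 1 - 2 * i)) p), projM_mem i j _⟩ = 0 := by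
    rw [Submodule.mkQ_apply, Submodule.Quotient.mk_eq_zero, relM, Submodule.mem_comap]
    refine Submodule.subset_span ⟨p, hp, ?_⟩
    rw [← linD_pow_apply]
    exact (projM_of_mem hmem).symm
  rw [lam_eq, this, map_zero, Finsupp.zero_apply]

lemma exists_of_lam_eq_zero {g i j : ℕ} {p : MvPolynomial ℕ ℚ} (hp : p ∈ homog i j)
    (h : ∀ m, lam g i j m p = 0) :
    ∃ y ∈ Mij (g + j + 1 - i) j, ∃ q ∈ homog ((i : ℤ) - 1) j,
      p = (linD g ^ (g + j + 1 - 2 * i)) y + X 0 * q := by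
  obtain ⟨q, hq, hpq⟩ := exists_eq_projM_add hp
  have h0 : (relM g i j).mkQ ⟨projM i j p, projM_mem i j p⟩ = 0 :=
    (quotBasis g i j).ext_elem fun m => by
      rw [map_zero, Finsupp.zero_apply]; exact h m
  rw [Submodule.mkQ_apply, Submodule.Quotient.mk_eq_zero, relM, Submodule.mem_comap] at h0
  have himg : (Dop g)^[g + j + 1 - 2 * i] '' (Mij (g + j + 1 - i) j : Set (MvPolynomial ℕ ℚ)) =
      ((Mij (g + j + 1 - i) j).map (linD g ^ (g + j + 1 - 2 * i)) : Set (MvPolynomial ℕ ℚ)) := by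
    rw [Submodule.map_coe]
    exact Set.image_congr fun x _ => (linD_pow_apply g _ x).symm
  rw [himg, Submodule.span_eq] at h0
  obtain ⟨y, hy, hyp⟩ := h0
  refine ⟨y, hy, q, hq, ?_⟩
  rw [hyp, Submodule.subtype_apply]
  exact hpq

lemma exists_lam_eq_single {g i j : ℕ} (m : Fin (muIJ g i j)) :
    ∃ p ∈ Mij i j, ∀ m', lam g i j m' p = if m' = m then 1 else 0 := by
  obtain ⟨⟨p, hp⟩, h⟩ := (relM g i j).mkQ_surjective
    (quotBasis g i j m)
  refine ⟨p, hp, fun m' => ?_⟩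
  have hpp : (⟨projM i j p, projM_mem i j p⟩ : Mij i j) = ⟨p, hp⟩ := Subtype.ext (projM_of_mem hp)
  rw [lam_eq, hpp, h, Module.Basis.repr_self, Finsupp.single_apply]
  simp [eq_comm]

lemma lam_linD_pow_eq_zero {g i j : ℕ} (m : Fin (muIJ g i j)) (hi : 2 * i ≤ g + j)
    {p : MvPolynomial ℕ ℚ} (hp : p ∈ Rlev j) :
    lam g i j m ((linD g ^ (g + j + 1 - 2 * i)) p) = 0 := by
  suffices h : Rlev j ≤ LinearMap.ker (lam g i j m ∘ₗ (linD g ^ (g + j + 1 - 2 * i))) from h hp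
  refine Submodule.span_le.2 ?_
  rintro _ ⟨d, hd, rfl⟩
  rw [SetLike.mem_coe, LinearMap.mem_ker, LinearMap.comp_apply]
  have hm : monomial d (1 : ℚ) ∈ homog (codimW d) j := monomial_mem_homog rfl (by rw [hd]) 1
  rcases eq_or_ne (codimW d) (g + j + 1 - i) with hc | hc
  · rw [hc] at hm
    obtain ⟨q, hq, h⟩ := exists_eq_projM_add hm
    rw [h, map_add, map_add, lam_linD_pow_of_mem_Mij m hi (projM_mem _ _ _), zero_add,
      show g + j + 1 - 2 * i = (g + j - 2 * i) + 1 by omega, linD_pow_X_zero_mul g _ hq, map_add,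
      lam_X_zero_mul, zero_add, map_smul]
    have : ((g + j + 1 - i : ℕ) : ℤ) = g + j + 1 - i := by omega
    have h' : ((g + j - 2 * i : ℕ) : ℤ) = g + j - 2 * i := by omega
    rw [this, h', show (2 * ((g : ℤ) + j + 1 - i - 1) - j - g - (g + j - 2 * i)) = 0 by ring]
    simp
  · exact lam_of_mem_homog m (linD_pow_mem_homog g _ hm) (by omega)

lemma lam_linD_pow_X_zero_mul {g i j : ℕ} (m : Fin (muIJ g i j)) (t : ℕ)
    {p : MvPolynomial ℕ ℚ} (hp : p ∈ Rlev j) :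
    lam g i j m ((linD g ^ (t + 1)) (X 0 * p)) =
      ((t + 1) * (2 * i + t - j - g) : ℚ) * lam g i j m ((linD g ^ t) p) := by
  suffices h : Rlev j ≤ LinearMap.eqLocus
      (lam g i j m ∘ₗ (linD g ^ (t + 1)) ∘ₗ LinearMap.mulLeft ℚ (X 0))
      (((t + 1) * (2 * i + t - j - g) : ℚ) • (lam g i j m ∘ₗ (linD g ^ t))) from h hp
  refine Submodule.span_le.2 ?_
  rintro _ ⟨d, hd, rfl⟩
  have hm : monomial d (1 : ℚ) ∈ homog (codimW d) j := monomial_mem_homog rfl (by rw [hd]) 1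
  simp only [SetLike.mem_coe, LinearMap.mem_eqLocus, LinearMap.comp_apply, LinearMap.smul_apply,
    LinearMap.mulLeft_apply, smul_eq_mul]
  rw [linD_pow_X_zero_mul g t hm, map_add, lam_X_zero_mul, zero_add, map_smul, smul_eq_mul]
  rcases eq_or_ne (codimW d) (i + t) with hc | hc
  · rw [hc]
    congr 1
    push_cast
    ring
  · rw [lam_of_mem_homog m (linD_pow_mem_homog g t hm) (by omega), mul_zero, mul_zero]

/-- The coordinate of the index `(i, m, k)` of the homomorphism `R_{(j)} → Tspace g j`. -/
def coordPhi (g i j : ℕ) (m : Fin (muIJ g i j)) (k : ℕ) : MvPolynomial ℕ ℚ →ₗ[ℚ] ℚ :=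
  ((k.factorial : ℚ) * (-1) ^ (g + j - 2 * i - k)) •
    (lam g i j m ∘ₗ (linD g ^ (g + j - 2 * i - k)))

lemma coordPhi_apply (g i j : ℕ) (m : Fin (muIJ g i j)) (k : ℕ) (p : MvPolynomial ℕ ℚ) :
    coordPhi g i j m k p = (k.factorial : ℚ) * (-1) ^ (g + j - 2 * i - k) *
      lam g i j m ((linD g ^ (g + j - 2 * i - k)) p) := rfl

lemma coordPhi_of_mem_homog {g i j : ℕ} (m : Fin (muIJ g i j)) (k : ℕ) {i' j' : ℤ}
    {p : MvPolynomial ℕ ℚ} (hp : p ∈ homog i' j')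
    (h : ¬ (i' = i + (g + j - 2 * i - k : ℕ) ∧ j' = j)) : coordPhi g i j m k p = 0 := by
  rw [coordPhi_apply, lam_of_mem_homog m (linD_pow_mem_homog g _ hp) (by omega), mul_zero]

/-- The homomorphism of `sl₂`-modules `R_{(j)} → Tspace g j`, extended by zero. -/
def Phi (g j : ℕ) : MvPolynomial ℕ ℚ →ₗ[ℚ] Tspace g j where
  toFun p := fun i m k => coordPhi g i j m k p
  map_add' p q := by
    funext i m k
    exact map_add _ p q
  map_smul' c p := by
    funext i m k
    exact map_smul _ c p

lemma Phi_apply (g j : ℕ) (p : MvPolynomial ℕ ℚ) (i : idxSet g j) (m : Fin (muIJ g i j))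
    (k : Fin (g + j - 2 * (i : ℕ) + 1)) : Phi g j p i m k = coordPhi g i j m k p := rfl

lemma Phi_eq_zero_iff (g j : ℕ) (p : MvPolynomial ℕ ℚ) :
    Phi g j p = 0 ↔ ∀ (i : idxSet g j) (m : Fin (muIJ g i j))
      (k : Fin (g + j - 2 * (i : ℕ) + 1)), coordPhi g i j m k p = 0 := by
  constructor
  · intro h i m k
    exact congrFun (congrFun (congrFun h i) m) k
  · intro h
    funext i m k
    exact h i m k

lemma mem_idxSet {g j i : ℕ} (hg : 1 ≤ g) :
    i ∈ idxSet g j ↔ j ≤ i ∧ i < g ∧ i ≤ 2 * j ∧ 2 * i ≤ g + j := by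
  rw [idxSet, Finset.mem_Icc]
  omega

lemma Phi_X_zero_mul {g j : ℕ} (hg : 1 ≤ g) {p : MvPolynomial ℕ ℚ} (hp : p ∈ Rlev j) :
    Phi g j (X 0 * p) = eT g j (Phi g j p) := by
  funext i m k
  obtain ⟨_, _, _, hi⟩ := (mem_idxSet hg).1 i.2
  rw [Phi_apply, coordPhi_apply, eT, eV]
  have hk := k.2
  split_ifs with h
  · rw [Phi_apply, coordPhi_apply]
    obtain ⟨t, ht⟩ : ∃ t, g + j - 2 * (i : ℕ) = k + (t + 1) := ⟨g + j - 2 * (i : ℕ) - k - 1, by omega⟩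
    have hZ : (g : ℚ) + j - 2 * (i : ℕ) = k + (t + 1) := by
      have h' : g + j = 2 * (i : ℕ) + (k + (t + 1)) := by omega
      have : ((g + j : ℕ) : ℚ) = ((2 * (i : ℕ) + (k + (t + 1)) : ℕ) : ℚ) :=
        congrArg Nat.cast h'
      push_cast at this
      linarith
    simp only [ht]
    rw [show (k : ℕ) + (t + 1) - k = t + 1 by omega, show (k : ℕ) + (t + 1) - (k + 1) = t by omega,
      lam_linD_pow_X_zero_mul m t hp, Nat.factorial_succ,
      show (2 * (i : ℕ) + t - j - g : ℚ) = -(k + 1) by linarith]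
    push_cast
    ring
  · rw [show g + j - 2 * (i : ℕ) - k = 0 by omega, pow_zero, pow_zero, Module.End.one_apply,
      lam_X_zero_mul, mul_zero]

lemma Phi_linD {g j : ℕ} (hg : 1 ≤ g) {p : MvPolynomial ℕ ℚ} (hp : p ∈ Rlev j) :
    Phi g j (linD g p) = - fT g j (Phi g j p) := by
  funext i m k
  obtain ⟨_, _, _, hi⟩ := (mem_idxSet hg).1 i.2
  change Phi g j (linD g p) i m k = -(fT g j (Phi g j p) i m k)
  rw [Phi_apply, coordPhi_apply, fT, fV, Phi_apply, coordPhi_apply, ← Module.End.mul_apply,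
    ← pow_succ]
  have hk := k.2
  rcases Nat.eq_zero_or_pos (k : ℕ) with h | h
  · rw [show g + j - 2 * (i : ℕ) - k + 1 = g + j + 1 - 2 * i by omega,
      lam_linD_pow_eq_zero m hi hp]
    simp [h]
  · obtain ⟨k', hk'⟩ : ∃ k', (k : ℕ) = k' + 1 := ⟨k - 1, by omega⟩
    obtain ⟨t, ht⟩ : ∃ t, g + j - 2 * (i : ℕ) = k + t := ⟨g + j - 2 * (i : ℕ) - k, by omega⟩
    simp only [ht, hk']
    rw [show k' + 1 + t - (k' + 1) = t by omega, show k' + 1 + t - (k' + 1 - 1) = t + 1 by omega,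
      Nat.add_sub_cancel, Nat.factorial_succ]
    push_cast
    ring

lemma hT_Phi {g j : ℕ} (hg : 1 ≤ g) {i : ℕ} {p : MvPolynomial ℕ ℚ} (hp : p ∈ Rij i j) :
    hT g j (Phi g j p) = (2 * (i : ℚ) - j - g) • Phi g j p := by
  funext i' m k
  obtain ⟨_, _, _, hi⟩ := (mem_idxSet hg).1 i'.2
  change hT g j (Phi g j p) i' m k = (2 * (i : ℚ) - j - g) * Phi g j p i' m k
  rw [hT, hV, Phi_apply]
  have hk := k.2
  rw [Rij_eq_homog] at hp
  rcases eq_or_ne i (i' + (g + j - 2 * i' - k)) with h | h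
  · congr 1
    have h1 : i + i' + k = g + j := by omega
    have h2 : ((i + i' + k : ℕ) : ℚ) = ((g + j : ℕ) : ℚ) := by rw [h1]
    push_cast at h2
    rw [Nat.cast_sub hi]
    push_cast
    linarith
  · rw [coordPhi_of_mem_homog m k hp (by omega), mul_zero, mul_zero]

lemma homog_le_Rlev (i : ℤ) (j : ℕ) : homog i j ≤ Rlev j := fun _ hp =>
  mem_of_monomials_mem fun d hd => Submodule.subset_span
    ⟨d, by have := (homog_support hp hd).2; omega, rfl⟩

lemma X_zero_mul_mem_Rlev {j : ℕ} {p : MvPolynomial ℕ ℚ} (hp : p ∈ Rlev j) : X 0 * p ∈ Rlev j := by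
  suffices h : Rlev j ≤ (Rlev j).comap (LinearMap.mulLeft ℚ (X 0)) from h hp
  refine Submodule.span_le.2 ?_
  rintro _ ⟨d, hd, rfl⟩
  exact homog_le_Rlev _ j (X_zero_mul_mem_homog (monomial_mem_homog rfl (by rw [hd]) 1))

lemma Ipol_le_ker_Phi {g : ℕ} (hg : 1 ≤ g) (j : ℕ) : Ipol g ≤ LinearMap.ker (Phi g j) := by
  refine Ipol_le (fun d hd => ?_) (fun n d hd hd' => ?_)
  · rw [LinearMap.mem_ker, Phi_eq_zero_iff]
    intro i m k
    have hi := (mem_idxSet hg).1 i.2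
    exact coordPhi_of_mem_homog m k (monomial_mem_homog (d := d) rfl rfl 1) (by omega)
  · have hm : monomial d (1 : ℚ) ∈ homog g (levelW d) := monomial_mem_homog (by rw [hd]) rfl 1
    rcases eq_or_ne (levelW d) j with hj | hj
    · rw [hj] at hm hd'
      induction n with
      | zero =>
        rw [pow_zero, Module.End.one_apply, LinearMap.mem_ker, Phi_eq_zero_iff]
        intro i m k
        have hi := (mem_idxSet hg).1 i.2
        rcases eq_or_ne (i : ℕ) j with hij | hij
        · obtain ⟨p, hp, h1⟩ := exists_lam_eq_single m
          have hp0 : p = 0 := by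
            refine homog_eq_zero_of_forall (Mij_le_homog _ _ hp) fun d' h h' => ?_
            have := levelW_lt_codimW (d := d') (by omega)
            omega
          have := h1 m
          simp [hp0] at this
        · exact coordPhi_of_mem_homog m k hm (by omega)
      | succ n ih =>
        rw [pow_succ', Module.End.mul_apply, LinearMap.mem_ker,
          Phi_linD hg (homog_le_Rlev _ j (linD_pow_mem_homog g n hm)), LinearMap.mem_ker.1 ih]
        funext i m k
        change -((k : ℚ) * 0) = 0
        simp
    · rw [LinearMap.mem_ker, Phi_eq_zero_iff]
      intro i m k
      exact coordPhi_of_mem_homog m k (linD_pow_mem_homog g n hm) (by omega)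

lemma fT_zero (g j : ℕ) : fT g j 0 = 0 := by
  funext i m k
  exact mul_zero _

lemma mem_Ipol_of_mem_homog_of_Phi_eq_zero {g j : ℕ} (hg : 3 ≤ g) (n : ℕ) :
    ∀ {i : ℤ} {p : MvPolynomial ℕ ℚ}, i < n → p ∈ homog i j → Phi g j p = 0 → p ∈ Ipol g := by
  induction n with
  | zero =>
    intro i p hi hp _
    rw [homog_eq_zero_of_neg (by simpa using hi) hp]
    exact zero_mem _
  | succ n ih =>
    intro i p hi hp h0
    have hD : linD g p ∈ Ipol g := by
      refine ih (i := i - 1) (by push_cast at hi; omega) (linD_mem_homog g hp) ?_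
      rw [Phi_linD (by omega) (homog_le_Rlev _ j hp), h0, fT_zero, neg_zero]
    rcases lt_or_ge 0 (2 * i - j - g) with hw | hw
    · refine mem_Ipol_of_weight_pos (g + 1) (c := 0) (by push_cast; omega) hw le_rfl hp ?_
      rw [zero_smul, sub_zero]
      exact X_zero_mul_mem_Ipol hD
    rcases lt_or_ge i j with hij | hij
    · have : p = 0 := homog_eq_zero_of_forall hp fun d h h' => by
        have := codimW_eq d
        omega
      rw [this]
      exact zero_mem _
    lift i to ℕ using by omega
    suffices hs : ∃ q ∈ Ipol g, ∃ r ∈ homog ((i : ℤ) - 1) j, p = q + X 0 * r by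
      obtain ⟨q, hq, r, hr, rfl⟩ := hs
      refine add_mem hq (X_zero_mul_mem_Ipol ?_)
      refine mem_Ipol_of_weight_neg i (c := 0) (by omega) (by omega) le_rfl hr ?_
      rw [zero_smul, sub_zero]
      rw [map_add] at hD
      exact (Submodule.add_mem_iff_right _ (linD_mem_Ipol hq)).1 hD
    rcases lt_or_ge (2 * j) i with h2 | h2
    · obtain ⟨r, hr, h⟩ := exists_eq_projM_add hp
      refine ⟨projM i j p, ?_, r, hr, h⟩
      have : projM i j p = 0 := by
        suffices hb : Mij i j ≤ ⊥ from (Submodule.mem_bot ℚ).1 (hb (projM_mem i j p))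
        refine Submodule.span_le.2 ?_
        rintro _ ⟨d, hd0, hd, hd', rfl⟩
        have := codimW_le_two_mul_levelW hd0
        omega
      rw [this]
      exact zero_mem _
    rcases lt_or_ge i g with hig | hig
    · have hi' : i ∈ idxSet g j := (mem_idxSet (by omega)).2 (by omega)
      have hlam : ∀ m, lam g i j m p = 0 := by
        intro m
        have := (Phi_eq_zero_iff g j p).1 h0 ⟨i, hi'⟩ m ⟨g + j - 2 * i, by simp⟩
        simpa [coordPhi_apply, Nat.factorial_ne_zero] using this
      obtain ⟨y, hy, q, hq, rfl⟩ := exists_of_lam_eq_zero hp hlam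
      have hs : (linD g ^ (g + j + 1 - 2 * i)) y ∈
          Ipol g ⊔ (homog ((i : ℤ) - 1) j).map (LinearMap.mulLeft ℚ (X 0)) := by
        refine linD_pow_mem_sup (g + 1) (by omega) (by omega) ?_
        rw [show ((i : ℤ) + (g + j + 1 - 2 * i : ℕ)) = (g + j + 1 - i : ℕ) by omega]
        exact Mij_le_homog _ _ hy
      obtain ⟨a, ha, _, ⟨r, hr, rfl⟩, har⟩ := Submodule.mem_sup.1 hs
      refine ⟨a, ha, r + q, add_mem hr hq, ?_⟩
      rw [← har, LinearMap.mulLeft_apply, mul_add, add_assoc]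
    · refine ⟨p, homog_le_Ipol (by omega) (by omega) hp, 0, zero_mem _, by simp⟩

lemma exists_homog_decomposition {j : ℕ} {p : MvPolynomial ℕ ℚ} (hp : p ∈ Rlev j) :
    ∃ f : ℕ →₀ MvPolynomial ℕ ℚ, (∀ i : ℕ, f i ∈ homog i j) ∧ (f.sum fun _ q => q) = p := by
  rw [← Submodule.mem_iSup_iff_exists_finsupp (fun i : ℕ => homog i j)]
  suffices h : Rlev j ≤ ⨆ i : ℕ, homog i j from h hp
  refine Submodule.span_le.2 ?_
  rintro _ ⟨d, hd, rfl⟩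
  exact Submodule.mem_iSup_of_mem (codimW d) (monomial_mem_homog rfl (by rw [hd]) 1)

lemma mem_Ipol_of_Phi_eq_zero {g j : ℕ} (hg : 3 ≤ g) {p : MvPolynomial ℕ ℚ} (hp : p ∈ Rlev j)
    (h : Phi g j p = 0) : p ∈ Ipol g := by
  obtain ⟨f, hf, rfl⟩ := exists_homog_decomposition hp
  refine sum_mem fun i _ => ?_
  refine mem_Ipol_of_mem_homog_of_Phi_eq_zero hg (i + 1) (by push_cast; omega) (hf i) ?_
  rw [Phi_eq_zero_iff] at h ⊢
  intro i' m k
  rcases eq_or_ne i (i' + (g + j - 2 * i' - k)) with hi | hi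
  · have hs := h i' m k
    rw [Finsupp.sum, map_sum, Finset.sum_eq_single i] at hs
    · exact hs
    · intro i'' _ hne
      exact coordPhi_of_mem_homog m k (hf i'') (by omega)
    · intro hn
      rw [Finsupp.notMem_support_iff.1 hn, map_zero]
  · exact coordPhi_of_mem_homog m k (hf i) (by omega)

/-- Projection of `Tspace g j` to the isotypic component of index `i`. -/
def isotypicProj (g j : ℕ) (i : idxSet g j) :
    Tspace g j →ₗ[ℚ] (Fin (muIJ g i j) → Fin (g + j - 2 * (i : ℕ) + 1) → ℚ) where
  toFun t := t i
  map_add' _ _ := rfl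
  map_smul' _ _ := rfl

lemma eT_apply_eq_zero {g j : ℕ} {t : Tspace g j} {i : idxSet g j} (h : t i = 0) :
    eT g j t i = 0 := by
  funext m k
  rw [eT, h, eV]
  split_ifs <;> simp

lemma eV_single {n : ℕ} (k : ℕ) (hk : k + 1 < n + 1) :
    eV n (Pi.single ⟨k + 1, hk⟩ 1) = ((n : ℚ) - k) • Pi.single ⟨k, by omega⟩ (1 : ℚ) := by
  funext l
  rw [eV, Pi.smul_apply, smul_eq_mul]
  by_cases hl : (l : ℕ) = k
  · subst hl
    rw [dif_pos hk, Pi.single_eq_same, Pi.single_eq_same]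
  · have hne : l ≠ ⟨k, by omega⟩ := fun h => hl (Fin.ext_iff.1 h)
    rw [Pi.single_eq_of_ne hne, mul_zero]
    split_ifs with h
    · rw [Pi.single_eq_of_ne (fun h' => hl (by simpa using Fin.ext_iff.1 h')), mul_zero]
    · rfl

lemma pi_eq_top_of_single_mem {a b : ℕ} {S : Submodule ℚ (Fin a → Fin b → ℚ)}
    (h : ∀ m k, Pi.single m (Pi.single k 1) ∈ S) : S = ⊤ := by
  rw [eq_top_iff]
  intro v _
  rw [← Finset.univ_sum_single v]
  refine S.sum_mem fun m _ => ?_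
  have hk : ∀ k, Pi.single k 1 ∈ S.comap (LinearMap.single ℚ (fun _ : Fin a => Fin b → ℚ) m) := h m
  suffices hv : v m ∈ S.comap (LinearMap.single ℚ (fun _ : Fin a => Fin b → ℚ) m) from hv
  rw [pi_eq_sum_univ' (v m)]
  refine Submodule.sum_mem _ fun k _ => Submodule.smul_mem _ _ ?_
  convert hk k using 1

lemma exists_Phi_eq_single {g j : ℕ} (hg : 1 ≤ g) (i : idxSet g j) (m : Fin (muIJ g i j)) (a : ℕ) :
    ∀ (k : Fin (g + j - 2 * (i : ℕ) + 1)), (k : ℕ) + a = g + j - 2 * (i : ℕ) →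
    ∃ p ∈ Rlev j, Phi g j p i = Pi.single m (Pi.single k 1) ∧
      ∀ i' : idxSet g j, (i : ℕ) < i' → Phi g j p i' = 0 := by
  obtain ⟨hi1, hi2, hi3, hi4⟩ := (mem_idxSet hg).1 i.2
  induction a with
  | zero =>
    intro k hk
    obtain ⟨p, hp, hlam⟩ := exists_lam_eq_single m
    have hp' := Mij_le_homog _ _ hp
    refine ⟨((g + j - 2 * (i : ℕ)).factorial : ℚ)⁻¹ • p,
      Submodule.smul_mem _ _ (homog_le_Rlev _ j hp'), ?_, ?_⟩
    · funext m' k'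
      rw [map_smul]
      change ((g + j - 2 * (i : ℕ)).factorial : ℚ)⁻¹ * Phi g j p i m' k' = _
      rw [Phi_apply]
      rcases eq_or_ne k' k with rfl | hne
      · have hf : ((g + j - 2 * (i : ℕ)).factorial : ℚ) = (k' : ℕ).factorial :=
          congrArg (fun x : ℕ => (x.factorial : ℚ)) hk.symm
        rw [coordPhi_apply, hf, show g + j - 2 * (i : ℕ) - k' = 0 by omega, pow_zero, pow_zero,
          Module.End.one_apply, hlam, mul_one, ← mul_assoc, inv_mul_cancel₀ (by positivity),
          one_mul, Pi.single_apply]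
        split_ifs <;> simp
      · have h1 := k'.2
        have h2 : (k' : ℕ) ≠ k := fun h => hne (Fin.ext h)
        rw [coordPhi_of_mem_homog m' k' hp' (by omega), mul_zero, Pi.single_apply]
        split_ifs
        · rw [Pi.single_eq_of_ne hne]
        · rfl
    · intro i' hi'
      funext m' k'
      rw [map_smul]
      change ((g + j - 2 * (i : ℕ)).factorial : ℚ)⁻¹ * Phi g j p i' m' k' = 0
      rw [Phi_apply, coordPhi_of_mem_homog m' k' hp' (by omega), mul_zero]
  | succ a ih =>
    intro k hk
    obtain ⟨p, hp, h1, h2⟩ := ih ⟨k + 1, by omega⟩ (by simp only; omega)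
    have hc : ((g + j - 2 * (i : ℕ) : ℕ) : ℚ) - (k : ℕ) = (a + 1 : ℕ) := by
      have h : (((k : ℕ) + (a + 1 : ℕ) : ℕ) : ℚ) = (g + j - 2 * (i : ℕ) : ℕ) := congrArg Nat.cast hk
      rw [Nat.cast_add] at h
      linarith
    refine ⟨((a + 1 : ℕ) : ℚ)⁻¹ • (X 0 * p), Submodule.smul_mem _ _ (X_zero_mul_mem_Rlev hp), ?_, ?_⟩
    · rw [map_smul, Phi_X_zero_mul hg hp]
      funext m' k'
      change ((a + 1 : ℕ) : ℚ)⁻¹ * eV (g + j - 2 * (i : ℕ)) (Phi g j p i m') k' = _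
      rw [h1, Pi.single_apply, Pi.single_apply]
      split_ifs
      · rw [eV_single (k : ℕ), hc, Pi.smul_apply, smul_eq_mul, ← mul_assoc,
          inv_mul_cancel₀ (by positivity), one_mul]
      · rw [eV]
        split_ifs <;> simp
    · intro i' hi'
      rw [map_smul, Phi_X_zero_mul hg hp]
      change ((a + 1 : ℕ) : ℚ)⁻¹ • eT g j (Phi g j p) i' = 0
      rw [eT_apply_eq_zero (h2 i' hi'), smul_zero]

lemma mem_map_Phi {g j : ℕ} (hg : 1 ≤ g) (n : ℕ) : ∀ t : Tspace g j,
    (∀ i : idxSet g j, n ≤ i → t i = 0) → t ∈ (Rlev j).map (Phi g j) := by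
  induction n with
  | zero =>
    intro t ht
    have : t = 0 := by
      funext i
      exact ht i (Nat.zero_le _)
    rw [this]
    exact zero_mem _
  | succ n ih =>
    intro t ht
    by_cases hn : n ∈ idxSet g j
    · set i : idxSet g j := ⟨n, hn⟩
      let W : Submodule ℚ (Tspace g j) := (Rlev j).map (Phi g j) ⊓
        ⨅ i' : idxSet g j, ⨅ _ : n < (i' : ℕ), LinearMap.ker (isotypicProj g j i')
      have htop : W.map (isotypicProj g j i) = ⊤ := by
        refine pi_eq_top_of_single_mem fun m k => ?_
        obtain ⟨p, hp, h1, h2⟩ := exists_Phi_eq_single hg i m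
          (g + j - 2 * (i : ℕ) - k) k (by have := k.2; omega)
        refine ⟨Phi g j p, ⟨⟨p, hp, rfl⟩, ?_⟩, h1⟩
        simp only [SetLike.mem_coe, Submodule.mem_iInf, LinearMap.mem_ker]
        exact h2
      obtain ⟨w, ⟨hw, hw'⟩, hwi⟩ : t i ∈ W.map (isotypicProj g j i) := by
        rw [htop]; trivial
      simp only [SetLike.mem_coe, Submodule.mem_iInf, LinearMap.mem_ker] at hw'
      rw [← sub_add_cancel t w]
      refine add_mem (ih _ fun i' hi' => ?_) hw
      change isotypicProj g j i' (t - w) = 0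
      rw [map_sub, sub_eq_zero]
      rcases hi'.eq_or_lt with h | h
      · obtain rfl : i = i' := Subtype.ext h
        exact hwi.symm
      · rw [hw' i' h]
        exact ht i' h
    · refine ih t fun i hi => ht i ?_
      have : n ≠ i := fun h => hn (h ▸ i.2)
      omega

/-- structure of `𝓡_{(j)}` as an sl₂-module:
`𝓡_{(j)} ≅ ⊕_{i=j}^{min(g−1,2j,⌊(g+j)/2⌋)} V(g−2i+j)^{⊕μ(i,j)}`.
We phrase the existence of such an isomorphism of sl₂-modules as the existence of a
ℚ-linear map `Φ` on `R` which, restricted to `R_{(j)}`, is surjective onto the target,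
has kernel exactly `I ∩ R_{(j)}` (so it induces a linear isomorphism `𝓡_{(j)} ≅ T`),
and intertwines the sl₂-actions: `e = x₁·(-)`, `f = −𝒟`, and `h` acting on `R^i_{(j)}`
by the scalar `2i − j − g`. -/
theorem stmt1 (g : ℕ) (hg : 3 ≤ g) (j : ℕ) :
    ∃ Φ : MvPolynomial ℕ ℚ →ₗ[ℚ] Tspace g j,
      Submodule.map Φ (Rlev j) = ⊤ ∧
      (∀ α ∈ Rlev j, Φ α = 0 ↔ α ∈ Ipol g) ∧
      (∀ α ∈ Rlev j, Φ (X 0 * α) = eT g j (Φ α)) ∧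
      (∀ α ∈ Rlev j, Φ (Dop g α) = - fT g j (Φ α)) ∧
      (∀ i : ℕ, ∀ α ∈ Rij i j, hT g j (Φ α) = (2 * (i : ℚ) - j - g) • Φ α) := by
  refine ⟨Phi g j, ?_, fun α hα => ⟨mem_Ipol_of_Phi_eq_zero hg hα, fun h => ?_⟩,
    fun α hα => Phi_X_zero_mul (by omega) hα, fun α hα => Phi_linD (by omega) hα,
    fun i α hα => hT_Phi (by omega) hα⟩
  · rw [eq_top_iff]
    intro t _
    refine mem_map_Phi (by omega) g t fun i hi => ?_
    have := (mem_idxSet (by omega)).1 i.2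
    omega
  · exact Ipol_le_ker_Phi (by omega) j h
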